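/- Let K be a field, V a K-vector space, and e ∈ End_K(V) an element with e^2 = e. Suppose there is an element x ∈ End_K(V) such that e = ∑_{i=0}^{m} x^i a_i, where for every 0 ≤ k ≤ m each [x^i a_i, x]_k can be rewritten as ∑_{i'=0}^{i} x^{i'} c_{i'} with c_{i'} in a nilpotent subalgebra S of End_K(V). Then e = 0. -/

import Mathlib

/-- Iterated commutator: `itc a b 0 = a`, `itc a b (k+1) = [itc a b k, b]`. -/
def itc {R : Type*} [Ring R] (a b : R) : ℕ → R
  | 0 => a
  | k + 1 => itc a b k * b - b * itc a b k

theorem itc_sum {R ι : Type*} [Ring R] (s : Finset ι) (f : ι → R) (b : R) (k : ℕ) :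
    itc (∑ i ∈ s, f i) b k = ∑ i ∈ s, itc (f i) b k := by
  induction k with
  | zero => rfl
  | succ k ih => simp only [itc, ih, Finset.sum_mul, Finset.mul_sum, Finset.sum_sub_distrib]

/-- If `p` is killed by `a * b ^ j` for all `j < k`, only the term `a * b ^ k` of the expansion of
`[a, b]_k` acts on `p`. -/
theorem itc_mul_of_forall_lt {R : Type*} [Ring R] (a b : R) (k : ℕ) (p : R)
    (hp : ∀ j < k, a * b ^ j * p = 0) : itc a b k * p = a * b ^ k * p := by
  induction k generalizing p with
  | zero => simp [itc]
  | succ k ih =>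
    have hbp : itc a b k * (b * p) = a * b ^ k * (b * p) :=
      ih _ fun j hj => by simpa [pow_succ, mul_assoc] using hp (j + 1) (by lia)
    have hzero : itc a b k * p = 0 :=
      (ih p fun j hj => hp j (by lia)).trans (hp k k.lt_succ_self)
    rw [itc, sub_mul, mul_assoc, hbp, mul_assoc b, hzero, mul_zero, sub_zero, pow_succ]
    simp only [mul_assoc]

/-- Let `S` be a set all of whose products of length `h` vanish. If for every `k ≤ m` the product
`e * [e, x]_k` kills each `p` for which all `e * x ^ j * s * p` with `j ≤ m`, `s ∈ S` vanish (as
happens when `[e, x]_k` is a sum of terms `x ^ j * s`), then the idempotent `e` is zero. -/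
theorem IsIdempotentElem.eq_zero_of_itc {R : Type*} [Ring R] {S : Set R} {h m : ℕ} {e x : R}
    (hS : ∀ L : List R, (∀ s ∈ L, s ∈ S) → L.length = h → L.prod = 0)
    (he : IsIdempotentElem e)
    (hc : ∀ k ≤ m, ∀ p : R, (∀ j ≤ m, ∀ s ∈ S, e * x ^ j * (s * p) = 0) →
      e * (itc e x k * p) = 0) :
    e = 0 := by
  have key : ∀ n : ℕ, ∀ L : List R, (∀ s ∈ L, s ∈ S) → L.length + n = h →
      ∀ k ≤ m, e * x ^ k * L.prod = 0 := by
    intro n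
    induction n with
    | zero =>
      intro L hL hlen k _
      rw [hS L hL hlen, mul_zero]
    | succ n ih =>
      intro L hL hlen k
      induction k using Nat.strong_induction_on with
      | _ k ihk =>
        intro hk
        have hzero := hc k hk L.prod fun j hj s hs => by
          rw [← List.prod_cons]
          exact ih (s :: L) (by simpa [hs] using hL) (by rw [List.length_cons]; lia) j hj
        rw [itc_mul_of_forall_lt e x k _ fun j hj => ihk j hj (by lia)] at hzero
        simpa only [← mul_assoc, he.eq] using hzero
  simpa using key h [] (by simp) (by simp) 0 m.zero_le

/-- Single-variable case of Lemma 13: if the idempotent `e = ∑_{i=0}^m x^i a_i` is such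
that each `[x^i a_i, x]_k` (`0 ≤ k ≤ m`) rewrites as `∑_{i'=0}^{i} x^{i'} c_{i'}` with
the `c_{i'}` in a nilpotent subalgebra `S` of `End_K(V)`, then `e = 0`. -/
theorem stmt_9 {K V : Type*} [Field K] [AddCommGroup V] [Module K V]
    (S : NonUnitalSubalgebra K (Module.End K V)) (h : ℕ) (hpos : 0 < h)
    (hSnil : ∀ f : Fin h → Module.End K V, (∀ t, f t ∈ S) → (List.ofFn f).prod = 0)
    (e x : Module.End K V) (m : ℕ) (a : ℕ → Module.End K V)
    (he : e * e = e)
    (heq : e = ∑ i ∈ Finset.range (m + 1), x ^ i * a i)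
    (hrw : ∀ i ≤ m, ∀ k ≤ m, ∃ c : ℕ → Module.End K V,
      (∀ i' ≤ i, c i' ∈ S) ∧
        itc (x ^ i * a i) x k = ∑ i' ∈ Finset.range (i + 1), x ^ i' * c i') :
    e = 0 := by
  refine IsIdempotentElem.eq_zero_of_itc (S := S) (h := h) (m := m) (x := x) ?_ he ?_
  · rintro L hL rfl
    simpa using hSnil L.get fun t => hL _ (L.get_mem t)
  · intro k hk p hp
    have hitc : itc e x k = ∑ i ∈ Finset.range (m + 1), itc (x ^ i * a i) x k := by
      rw [← itc_sum, ← heq]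
    rw [hitc, Finset.sum_mul, Finset.mul_sum]
    refine Finset.sum_eq_zero fun i hi => ?_
    have him : i ≤ m := Finset.mem_range_succ_iff.mp hi
    obtain ⟨c, hcS, hcsum⟩ := hrw i him k hk
    rw [hcsum, Finset.sum_mul, Finset.mul_sum]
    refine Finset.sum_eq_zero fun j hj => ?_
    have hji : j ≤ i := Finset.mem_range_succ_iff.mp hj
    simpa only [mul_assoc] using hp j (hji.trans him) (c j) (hcS j hji)
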